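/- Explicitly, the unique g of the previous statement is given by g = f + h · L(A,B)/(−f(x) · Δ_G h(x)), where h(v) is the probability that a simple random walk from v hits x before A ∪ B. -/

import Mathlib

open Filter

/-- The weight `P₀(γ) = 1/∏_{j=0}^{n-1} deg(γⱼ)` of a walk `γ = (γ₀,…,γₙ)`
(product of reciprocal degrees over all vertices except the last). -/
noncomputable def walkWeight {V : Type*} (G : SimpleGraph V) [G.LocallyFinite]
    {v w : V} (γ : G.Walk v w) : ℝ :=
  (γ.support.dropLast.map fun u => ((G.degree u : ℝ))⁻¹).prod

/-- The probability that the simple random walk on `G` started at `v` hits `A`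
before `B`: the sum of the weights of all walk trajectories from `v` ending at a
vertex of `A`, all of whose other vertices avoid `A ∪ B`. -/
noncomputable def hitBefore {V : Type*} (G : SimpleGraph V) [G.LocallyFinite]
    (A B : Set V) (v : V) : ℝ :=
  ∑' γ : (Σ a : A, {w : G.Walk v (a : V) // ∀ u ∈ w.support.dropLast, u ∉ A ∪ B}),
    walkWeight G (γ.2 : G.Walk v (γ.1 : V))

/-- The graph Laplacian `Δ_G f(v) = Σ_{w∼v} (f(w) − f(v))`. -/
noncomputable def graphLap {V : Type*} (G : SimpleGraph V) [G.LocallyFinite]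
    (f : V → ℝ) (v : V) : ℝ :=
  ∑ w ∈ G.neighborFinset v, (f w - f v)


namespace Hit

open scoped ENNReal

variable {V : Type*} (G : SimpleGraph V) [G.LocallyFinite]

open Classical in
noncomputable def c (Z : Set V) (v : V) : ℝ≥0∞ :=
  if v ∈ Z then 0 else ENNReal.ofReal ((G.degree v : ℝ)⁻¹)

open Classical in
noncomputable def e (Z : Set V) : ℕ → V → V → ℝ≥0∞
  | 0, v, s => if v = s then 1 else 0
  | k+1, v, s => c G Z v * ∑ w ∈ G.neighborFinset v, e Z k w s

noncomputable def I (Z : Set V) (k : ℕ) (v s : V) : ℝ≥0∞ :=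
  ∑ w ∈ G.neighborFinset v, e G Z k w s

noncomputable def F (S Z : Set V) (v : V) : ℝ≥0∞ :=
  ∑' s : S, ∑' k, e G Z k v s

lemma c_ne_top (Z : Set V) (v : V) : c G Z v ≠ ⊤ := by
  unfold c; split_ifs <;> simp

lemma c_mul_le (Z : Set V) (v : V) : c G Z v * (G.degree v : ℝ≥0∞) ≤ 1 := by
  unfold c
  split_ifs
  · simp
  · rcases Nat.eq_zero_or_pos (G.degree v) with h | h
    · simp [h]
    · have : (G.degree v : ℝ≥0∞) = ENNReal.ofReal (G.degree v : ℝ) := by simp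
      rw [this, ← ENNReal.ofReal_mul (by positivity), inv_mul_cancel₀ (by positivity)]
      simp

lemma c_sum_le (Z : Set V) (v : V) (M : ℝ≥0∞) (a : V → ℝ≥0∞) (ha : ∀ w, a w ≤ M) :
    c G Z v * ∑ w ∈ G.neighborFinset v, a w ≤ M := by
  calc c G Z v * ∑ w ∈ G.neighborFinset v, a w
      ≤ c G Z v * ∑ w ∈ G.neighborFinset v, M := by
        gcongr with w _; exact ha w
    _ = (c G Z v * (G.degree v : ℝ≥0∞)) * M := by
        simp [mul_assoc]
    _ ≤ 1 * M := by gcongr; exact c_mul_le G Z v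
    _ = M := one_mul _

lemma I_succ (Z : Set V) (k : ℕ) (v s : V) :
    I G Z (k+1) v s = ∑ w ∈ G.neighborFinset v, c G Z w * I G Z k w s := rfl

open Classical in
lemma I_zero (Z : Set V) (v s : V) : I G Z 0 v s = if G.Adj v s then 1 else 0 := by
  simp [I, e]

lemma I_succ' (Z : Set V) (k : ℕ) : ∀ (v s : V),
    I G Z (k+1) v s = ∑ w ∈ G.neighborFinset s, c G Z w * I G Z k v w := by
  classical
  induction k with
  | zero =>
    intro v s
    rw [I_succ]
    simp only [I_zero, mul_ite, mul_one, mul_zero]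
    rw [← Finset.sum_filter, ← Finset.sum_filter]
    apply Finset.sum_congr _ (fun _ _ => rfl)
    ext w
    simp [G.adj_comm, and_comm]
  | succ k ih =>
    intro v s
    rw [I_succ]
    have e1 : ∀ w, c G Z w * I G Z (k+1) w s =
        ∑ u ∈ G.neighborFinset s, c G Z w * (c G Z u * I G Z k w u) := fun w => by
      rw [ih, Finset.mul_sum]
    have e2 : ∀ u, c G Z u * I G Z (k+1) v u =
        ∑ w ∈ G.neighborFinset v, c G Z u * (c G Z w * I G Z k w u) := fun u => by
      rw [I_succ, Finset.mul_sum]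
    rw [Finset.sum_congr rfl fun w _ => e1 w, Finset.sum_congr rfl fun w _ => e2 w,
      Finset.sum_comm]
    refine Finset.sum_congr rfl fun u _ => Finset.sum_congr rfl fun w _ => ?_
    ring

lemma I_symm (Z : Set V) (k : ℕ) : ∀ (v s : V), I G Z k v s = I G Z k s v := by
  induction k with
  | zero => intro v s; classical simp [I_zero, G.adj_comm]
  | succ k ih =>
    intro v s
    rw [I_succ, I_succ']
    exact Finset.sum_congr rfl fun w _ => by rw [ih]

lemma sum_F (S Z : Set V) (v : V) :
    ∑ w ∈ G.neighborFinset v, F G S Z w = ∑' s : S, ∑' k, I G Z k v s := by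
  unfold F I
  rw [← Summable.tsum_finsetSum (fun _ _ => ENNReal.summable)]
  congr 1; ext s
  rw [← Summable.tsum_finsetSum (fun _ _ => ENNReal.summable)]

lemma reversal (S T Z : Set V) :
    ∑' t : T, ∑ w ∈ G.neighborFinset t, F G S Z w
      = ∑' s : S, ∑ w ∈ G.neighborFinset s, F G T Z w := by
  simp_rw [sum_F]
  rw [ENNReal.tsum_comm]
  refine tsum_congr fun s => tsum_congr fun t => tsum_congr fun k => ?_
  exact I_symm G Z k _ _

noncomputable def a (S Z : Set V) (k : ℕ) (v : V) : ℝ≥0∞ := ∑' s : S, e G Z k v s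

lemma F_eq (S Z : Set V) (v : V) : F G S Z v = ∑' k, a G S Z k v := by
  unfold F a; rw [ENNReal.tsum_comm]

open Classical in
lemma a_zero (S Z : Set V) (v : V) : a G S Z 0 v = if v ∈ S then 1 else 0 := by
  unfold a
  simp only [e]
  rw [tsum_subtype S (fun s => if v = s then (1 : ℝ≥0∞) else 0)]
  rw [tsum_eq_single v]
  · simp [Set.indicator]
  · intro b hb; simp [Set.indicator, hb.symm]

lemma a_succ (S Z : Set V) (k : ℕ) (v : V) :
    a G S Z (k+1) v = c G Z v * ∑ w ∈ G.neighborFinset v, a G S Z k w := by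
  unfold a
  simp only [e]
  rw [ENNReal.tsum_mul_left, Summable.tsum_finsetSum (fun _ _ => ENNReal.summable)]

lemma R_succ (S Z : Set V) (k : ℕ) (v : V) :
    ∑ j ∈ Finset.range (k+1), a G S Z j v =
      a G S Z 0 v + c G Z v * ∑ w ∈ G.neighborFinset v, ∑ j ∈ Finset.range k, a G S Z j w := by
  rw [Finset.sum_range_succ', add_comm]
  simp_rw [a_succ]
  rw [← Finset.mul_sum, Finset.sum_comm]

lemma F_step (S Z : Set V) (v : V) :
    F G S Z v = a G S Z 0 v + c G Z v * ∑ w ∈ G.neighborFinset v, F G S Z w := by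
  simp_rw [F_eq]
  rw [tsum_eq_zero_add' (f := fun k => a G S Z k v) ENNReal.summable]
  simp_rw [a_succ]
  rw [ENNReal.tsum_mul_left, Summable.tsum_finsetSum (fun _ _ => ENNReal.summable)]

lemma R_le (S Z : Set V) (hS : S ⊆ Z) (k : ℕ) : ∀ v,
    ∑ j ∈ Finset.range k, a G S Z j v ≤ 1 := by
  classical
  induction k with
  | zero => intro v; simp
  | succ k ih =>
    intro v
    rw [R_succ]
    by_cases hv : v ∈ Z
    · simp only [c, hv, if_true, zero_mul, add_zero, a_zero]
      split_ifs <;> simp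
    · have : v ∉ S := fun h => hv (hS h)
      simp only [a_zero, this, if_false, zero_add]
      exact c_sum_le G Z v 1 _ ih

lemma F_le (S Z : Set V) (hS : S ⊆ Z) (v : V) : F G S Z v ≤ 1 := by
  rw [F_eq]
  exact ENNReal.tsum_le_of_sum_range_le (fun k => R_le G S Z hS k v)

noncomputable def r (S Z : Set V) (v : V) : ℝ := (F G S Z v).toReal

lemma r_nonneg (S Z : Set V) (v : V) : 0 ≤ r G S Z v := ENNReal.toReal_nonneg

lemma F_ne (S Z : Set V) (hS : S ⊆ Z) (v : V) : F G S Z v ≠ ⊤ :=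
  ne_top_of_le_ne_top (by simp) (F_le G S Z hS v)

lemma r_le (S Z : Set V) (hS : S ⊆ Z) (v : V) : r G S Z v ≤ 1 := by
  have := ENNReal.toReal_mono (by simp) (F_le G S Z hS v)
  rw [ENNReal.toReal_one] at this
  exact this

lemma r_abs (S Z : Set V) (hS : S ⊆ Z) (v : V) : |r G S Z v| ≤ 1 := by
  rw [abs_of_nonneg (r_nonneg ..)]; exact r_le G S Z hS v

lemma r_one (S Z : Set V) (hS : S ⊆ Z) (v : V) (hv : v ∈ S) : r G S Z v = 1 := by
  unfold r; rw [F_step, a_zero]; simp [c, hv, hS hv]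

lemma r_zero (S Z : Set V) (v : V) (hv : v ∈ Z) (hv' : v ∉ S) : r G S Z v = 0 := by
  unfold r; rw [F_step, a_zero]; simp [c, hv, hv']

lemma lap_eq (f : V → ℝ) (v : V) :
    graphLap G f v = ∑ w ∈ G.neighborFinset v, f w - (G.degree v : ℝ) * f v := by
  simp [graphLap, Finset.sum_sub_distrib]

lemma r_harm (S Z : Set V) (hS : S ⊆ Z) (v : V) (hv : v ∉ Z) :
    graphLap G (r G S Z) v = 0 := by
  rw [lap_eq]
  rcases Nat.eq_zero_or_pos (G.degree v) with h | h
  · have : G.neighborFinset v = ∅ := by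
      rw [← Finset.card_eq_zero]; simpa using h
    simp [h, this]
  · have h1 : r G S Z v = (G.degree v : ℝ)⁻¹ * ∑ w ∈ G.neighborFinset v, r G S Z w := by
      have : v ∉ S := fun h => hv (hS h)
      unfold r
      rw [F_step, a_zero, ← ENNReal.toReal_sum (fun w _ => F_ne G S Z hS w)]
      simp [c, hv, this]
    rw [h1, ← mul_assoc, mul_inv_cancel₀ (by positivity)]
    ring

lemma r_sum (S Z : Set V) (hS : S ⊆ Z) (v : V) :
    (∑ w ∈ G.neighborFinset v, F G S Z w) =
      ENNReal.ofReal (∑ w ∈ G.neighborFinset v, r G S Z w) := by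
  rw [ENNReal.ofReal_sum_of_nonneg (fun w _ => r_nonneg ..)]
  refine Finset.sum_congr rfl fun w _ => ?_
  rw [r, ENNReal.ofReal_toReal (F_ne G S Z hS w)]

lemma rev_real (S T Z : Set V) (hS : S ⊆ Z) (hT : T ⊆ Z)
    (hs : Summable fun t : T => ∑ w ∈ G.neighborFinset (t : V), r G S Z w) :
    HasSum (fun s : S => ∑ w ∈ G.neighborFinset (s : V), r G T Z w)
      (∑' t : T, ∑ w ∈ G.neighborFinset (t : V), r G S Z w) := by
  have h := reversal G S T Z
  simp_rw [r_sum G S Z hS, r_sum G T Z hT] at h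
  have n1 : ∀ (S : Set V) (v : V), 0 ≤ ∑ w ∈ G.neighborFinset v, r G S Z w :=
    fun S v => Finset.sum_nonneg fun w _ => r_nonneg ..
  rw [← ENNReal.ofReal_tsum_of_nonneg (fun t : T => n1 S t) hs] at h
  have h3 : ∑' s : S, ENNReal.ofReal (∑ w ∈ G.neighborFinset (s : V), r G T Z w) ≠ ⊤ := by
    rw [← h]; simp
  have h4 := ENNReal.hasSum_toReal h3
  rw [← ENNReal.tsum_toReal_eq (by simp), ← h,
    ENNReal.toReal_ofReal (tsum_nonneg fun t : T => n1 S t)] at h4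
  refine h4.congr_fun ?_ |> id
  intro s
  simp [ENNReal.toReal_ofReal (n1 T s)]

lemma uniq (Z : Set V) (hZ : ∀ v, v ∉ Z → r G Z Z v = 1) (u : V → ℝ) (M : ℝ)
    (hM : ∀ v, |u v| ≤ M) (hu : ∀ v, u v = 0 ∨ (v ∉ Z ∧ graphLap G u v = 0)) :
    ∀ v, u v = 0 := by
  classical
  have key : ∀ k v, ENNReal.ofReal |u v| +
      ENNReal.ofReal M * ∑ j ∈ Finset.range k, a G Z Z j v ≤ ENNReal.ofReal M := by
    intro k
    induction k with
    | zero => intro v; simpa using ENNReal.ofReal_le_ofReal (hM v)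
    | succ k ih =>
      intro v
      rcases hu v with h | ⟨hv, h⟩
      · rw [h]; simp only [abs_zero, ENNReal.ofReal_zero, zero_add]
        exact mul_le_of_le_one_right' (R_le G Z Z le_rfl _ v)
      · rw [R_succ, a_zero]
        simp only [hv, if_false, zero_add]
        rcases Nat.eq_zero_or_pos (G.degree v) with hd | hd
        · simpa [c, hd] using ENNReal.ofReal_le_ofReal (hM v)
        · rw [lap_eq] at h
          have h1 : |u v| ≤ (G.degree v : ℝ)⁻¹ * ∑ w ∈ G.neighborFinset v, |u w| := by
            rw [le_inv_mul_iff₀ (by positivity)]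
            calc (G.degree v : ℝ) * |u v| = |(G.degree v : ℝ) * u v| := by
                  rw [abs_mul, abs_of_nonneg (by positivity : (0:ℝ) ≤ G.degree v)]
              _ = |∑ w ∈ G.neighborFinset v, u w| := by congr 1; linarith
              _ ≤ _ := Finset.abs_sum_le_sum_abs _ _
          have h2 : ENNReal.ofReal |u v| ≤
              c G Z v * ∑ w ∈ G.neighborFinset v, ENNReal.ofReal |u w| := by
            refine (ENNReal.ofReal_le_ofReal h1).trans ?_
            rw [ENNReal.ofReal_mul (by positivity),
              ENNReal.ofReal_sum_of_nonneg (fun w _ => abs_nonneg _)]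
            simp [c, hv]
          calc _ ≤ c G Z v * ∑ w ∈ G.neighborFinset v, ENNReal.ofReal |u w| +
                ENNReal.ofReal M * (c G Z v * ∑ w ∈ G.neighborFinset v,
                  ∑ j ∈ Finset.range k, a G Z Z j w) := by gcongr
            _ = c G Z v * ∑ w ∈ G.neighborFinset v, (ENNReal.ofReal |u w| +
                ENNReal.ofReal M * ∑ j ∈ Finset.range k, a G Z Z j w) := by
                  rw [Finset.sum_add_distrib, ← Finset.mul_sum]; ring
            _ ≤ _ := c_sum_le G Z v _ _ ih
  intro v
  rcases hu v with h | ⟨hv, -⟩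
  · exact h
  have hF : F G Z Z v = 1 := by
    have := hZ v hv
    unfold r at this
    rwa [ENNReal.toReal_eq_one_iff] at this
  have h1 : ENNReal.ofReal M * F G Z Z v ≤ ENNReal.ofReal M - ENNReal.ofReal |u v| := by
    rw [F_eq, ← ENNReal.tsum_mul_left]
    refine ENNReal.tsum_le_of_sum_range_le fun k => ?_
    rw [← Finset.mul_sum]
    exact ENNReal.le_sub_of_add_le_left (by simp) (key k v)
  rw [hF, mul_one] at h1
  have hle := ENNReal.ofReal_le_ofReal (hM v)
  have h2 : ENNReal.ofReal M + ENNReal.ofReal |u v| ≤ ENNReal.ofReal M + 0 := by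
    calc _ ≤ (ENNReal.ofReal M - ENNReal.ofReal |u v|) + ENNReal.ofReal |u v| := by gcongr
      _ = _ := by rw [tsub_add_cancel_of_le hle, add_zero]
  have h3 := (ENNReal.add_le_add_iff_left (by simp)).1 h2
  have h4 : |u v| ≤ 0 := by simpa using h3
  exact abs_nonpos_iff.1 h4

noncomputable def W (Z : Set V) {v s : V} (p : G.Walk v s) : ℝ≥0∞ :=
  (p.support.dropLast.map (c G Z)).prod

lemma W_cons (Z : Set V) {v w s : V} (h : G.Adj v w) (p : G.Walk w s) :
    W G Z (SimpleGraph.Walk.cons h p) = c G Z v * W G Z p := by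
  unfold W
  rw [SimpleGraph.Walk.support_cons, List.dropLast_cons_of_ne_nil (by simp)]
  simp

open Classical in
lemma walk_len (Z : Set V) (k : ℕ) : ∀ v s : V,
    ∑' p : G.Walk v s, (if p.length = k then W G Z p else 0) = e G Z k v s := by
  induction k with
  | zero =>
    intro v s
    by_cases h : v = s
    · subst h
      rw [tsum_eq_single SimpleGraph.Walk.nil]
      · simp [W, e]
      · intro p hp
        rw [if_neg]
        intro h0
        exact hp (SimpleGraph.Walk.nil_iff_eq_nil.1 (SimpleGraph.Walk.length_eq_zero_iff.1 h0))
    · simp only [e, h, if_false]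
      rw [ENNReal.tsum_eq_zero]
      intro p
      rw [if_neg]
      intro h0
      exact h (SimpleGraph.Walk.eq_of_length_eq_zero h0)
  | succ k ih =>
    intro v s
    let φ : (Σ w : G.neighborSet v, G.Walk (w : V) s) → G.Walk v s :=
      fun q => SimpleGraph.Walk.cons q.1.2 q.2
    have hφ : Function.Injective φ := by
      rintro ⟨⟨w, hw⟩, p⟩ ⟨⟨w', hw'⟩, p'⟩ h
      simp only [φ, SimpleGraph.Walk.cons.injEq] at h
      obtain ⟨rfl, h⟩ := h
      simpa using h
    rw [← hφ.tsum_eq]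
    · rw [ENNReal.tsum_sigma']
      have e1 : ∀ (w : G.neighborSet v) (p : G.Walk (w : V) s),
          (if (φ ⟨w, p⟩).length = k + 1 then W G Z (φ ⟨w, p⟩) else 0) =
            c G Z v * (if p.length = k then W G Z p else 0) := by
        intro w p
        have h1 : (φ ⟨w, p⟩).length = p.length + 1 := rfl
        have h2 : W G Z (φ ⟨w, p⟩) = c G Z v * W G Z p := W_cons G Z w.2 p
        rw [h1, h2]
        simp
      have e2 : ∀ w : G.neighborSet v, ∑' p : G.Walk (w : V) s,
          (if (φ ⟨w, p⟩).length = k + 1 then W G Z (φ ⟨w, p⟩) else 0) =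
            c G Z v * e G Z k w s := by
        intro w
        rw [tsum_congr (e1 w), ENNReal.tsum_mul_left, ih]
      rw [tsum_congr e2, tsum_fintype, ← Finset.mul_sum]
      simp only [e]
      congr 1
      rw [SimpleGraph.neighborFinset]
      exact (Finset.sum_set_coe (G.neighborSet v) (f := fun w => e G Z k w s))
    · intro p hp
      cases p with
      | nil => simp at hp
      | cons h p => exact ⟨⟨⟨_, h⟩, p⟩, rfl⟩

lemma walk_sum (Z : Set V) (v s : V) : ∑' p : G.Walk v s, W G Z p = ∑' k, e G Z k v s := by
  classical
  simp_rw [← walk_len]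
  rw [ENNReal.tsum_comm]
  simp

open Classical in
lemma W_eq (Z : Set V) {v s : V} (p : G.Walk v s) :
    W G Z p = if (∀ u ∈ p.support.dropLast, u ∉ Z) then ENNReal.ofReal (walkWeight G p) else 0 := by
  unfold W walkWeight
  generalize p.support.dropLast = l
  induction l with
  | nil => simp
  | cons b l ih =>
    rw [List.map_cons, List.prod_cons, ih]
    by_cases hb : b ∈ Z
    · simp [c, hb]
    · simp only [c, hb, if_false, List.mem_cons, forall_eq_or_imp, not_false_eq_true, true_and,
        List.map_cons, List.prod_cons]
      rw [ENNReal.ofReal_mul (by positivity)]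
      simp

lemma weight_nonneg {v s : V} (p : G.Walk v s) : 0 ≤ walkWeight G p := by
  unfold walkWeight
  apply List.prod_nonneg
  intro y hy
  simp only [List.mem_map] at hy
  obtain ⟨u, -, rfl⟩ := hy
  positivity

lemma hit_eq (S T : Set V) : hitBefore G S T = r G S (S ∪ T) := by
  classical
  ext v
  unfold hitBefore r F
  have : ∀ s : S, ∑' k, e G (S ∪ T) k v s =
      ∑' p : {w : G.Walk v (s : V) // ∀ u ∈ w.support.dropLast, u ∉ S ∪ T},
        ENNReal.ofReal (walkWeight G p.1) := by
    intro s
    rw [← walk_sum]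
    refine Eq.trans (tsum_congr fun p => ?_)
      (tsum_subtype {w : G.Walk v (s : V) | ∀ u ∈ w.support.dropLast, u ∉ S ∪ T}
      (fun p => ENNReal.ofReal (walkWeight G p))).symm
    refine (W_eq G (S ∪ T) p).trans ?_
    by_cases hp : ∀ u ∈ p.support.dropLast, u ∉ S ∪ T
    · rw [if_pos hp, Set.indicator_of_mem (by exact hp)]
    · rw [if_neg hp, Set.indicator_of_notMem (by exact hp)]
  rw [tsum_congr this]
  rw [← ENNReal.tsum_sigma' (fun γ : (Σ a : S, {w : G.Walk v (a : V) //
    ∀ u ∈ w.support.dropLast, u ∉ S ∪ T}) => ENNReal.ofReal (walkWeight G γ.2.1)),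
    ENNReal.tsum_toReal_eq (by simp)]
  simp_rw [ENNReal.toReal_ofReal (weight_nonneg G _)]

lemma lap_lin (f g : V → ℝ) (t : ℝ) (v : V) :
    graphLap G (fun v => f v + t * g v) v = graphLap G f v + t * graphLap G g v := by
  simp only [graphLap, Finset.mul_sum, ← Finset.sum_add_distrib]
  exact Finset.sum_congr rfl fun w _ => by ring

end Hit

/-- Explicitly, the unique `g` of the previous statement is given by
`g = f + h·L(A,B)/(−f(x)·Δ_G h(x))`, where `h(v)` is the probability that a simple
random walk from `v` hits `x` before `A ∪ B`. -/
theorem stmt14 {V : Type*} (G : SimpleGraph V) [G.LocallyFinite]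
    (hconn : G.Connected) (A B : Set V) (hAB : Disjoint A B)
    (hreach : ∀ v : V, v ∉ A ∪ B → hitBefore G (A ∪ B) ∅ v = 1)
    (hL : Summable fun v : B => graphLap G (hitBefore G A B) v)
    (x : V) (hx : x ∉ A ∪ B) (hfx : 0 < hitBefore G A B x) :
    ∀ g : V → ℝ,
      ((∃ M : ℝ, ∀ v : V, |g v| ≤ M) ∧ (∀ v ∈ A, g v = 1) ∧ (∀ v ∈ B, g v = 0) ∧
        (∀ v : V, v ∉ A ∪ B → v ≠ x → graphLap G g v = 0) ∧
        (∑' v : A, graphLap G g v) = 0) →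
      g = fun v =>
        hitBefore G A B v +
          hitBefore G {x} (A ∪ B) v *
            (∑' u : B, graphLap G (hitBefore G A B) u) /
            (-(hitBefore G A B x * graphLap G (hitBefore G {x} (A ∪ B)) x)) := by
  rintro g ⟨⟨M, hM⟩, gA, gB, gH, gS⟩
  simp only [Hit.hit_eq] at *
  rw [Set.union_empty] at hreach
  set Z := A ∪ B with hZ
  set Y := {x} ∪ Z with hY
  have AZ : A ⊆ Z := Set.subset_union_left
  have BZ : B ⊆ Z := Set.subset_union_right
  have ZY : Z ⊆ Y := Set.subset_union_right
  have xY : {x} ⊆ Y := Set.subset_union_left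
  have AY := AZ.trans ZY
  have xA : x ∉ A := fun h => hx (AZ h)
  have xB : x ∉ B := fun h => hx (BZ h)
  have nA : ∀ v ∈ B, v ∉ A := fun v hb ha => Set.disjoint_left.1 hAB ha hb
  have nY : ∀ v, v ∉ Z → v ≠ x → v ∉ Y := by
    intro v h1 h2 h3
    rcases h3 with h3 | h3
    · exact h2 h3
    · exact h1 h3
  set f := Hit.r G A Z with hf
  set h := Hit.r G {x} Y with hh
  have U := Hit.uniq G Z hreach
  have f1 : ∀ v ∈ A, f v = 1 := fun v hv => Hit.r_one G A Z AZ v hv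
  have f0 : ∀ v ∈ B, f v = 0 := fun v hv => Hit.r_zero G A Z v (BZ hv) (nA v hv)
  have fH : ∀ v, v ∉ Z → graphLap G f v = 0 := fun v hv => Hit.r_harm G A Z AZ v hv
  have hhx : h x = 1 := Hit.r_one G {x} Y xY x rfl
  have h0 : ∀ v ∈ Z, h v = 0 := fun v hv => Hit.r_zero G {x} Y v (ZY hv) (by
    rintro rfl; exact hx hv)
  have hH : ∀ v, v ∉ Z → v ≠ x → graphLap G h v = 0 :=
    fun v h1 h2 => Hit.r_harm G {x} Y xY v (nY v h1 h2)
  have hab : ∀ v, |h v| ≤ 1 := Hit.r_abs G {x} Y xY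
  have fab : ∀ v, |f v| ≤ 1 := Hit.r_abs G A Z AZ
  -- Laplacian of h at x is nonzero
  have hne : graphLap G h x ≠ 0 := by
    intro h3
    have := U h 1 hab (fun v => by
      by_cases hv : v ∈ Z
      · exact Or.inl (h0 v hv)
      · refine Or.inr ⟨hv, ?_⟩
        by_cases hvx : v = x
        · rw [hvx]; exact h3
        · exact hH v hv hvx) x
    rw [hhx] at this
    exact one_ne_zero this
  -- f' = 1 - f
  have ff : ∀ v, Hit.r G B Z v = 1 - f v := by
    have := U (fun v => (f v + 1 * Hit.r G B Z v) + (-1) * 1) 3 (fun v => by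
        have h1 := fab v
        have h2 := Hit.r_abs G B Z BZ v
        rw [abs_le] at *
        constructor <;> linarith) (fun v => by
      by_cases hv : v ∈ Z
      · left
        rcases hv with hv | hv
        · have : Hit.r G B Z v = 0 := Hit.r_zero G B Z v (AZ hv) (fun hb => nA v hb hv)
          simp [f1 v hv, this]
        · have : Hit.r G B Z v = 1 := Hit.r_one G B Z BZ v hv
          simp [f0 v hv, this]
      · refine Or.inr ⟨hv, ?_⟩
        rw [Hit.lap_lin G _ (fun _ => 1), Hit.lap_lin, fH v hv, Hit.r_harm G B Z BZ v hv]
        simp [graphLap])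
    intro v
    have := this v
    linarith
  -- q = f - f x * h
  have qq : ∀ v, Hit.r G A Y v = f v - f x * h v := by
    have := U (fun v => (f v + (-f x) * h v) + (-1) * Hit.r G A Y v) 3 (fun v => by
        have h1 := fab v
        have h2 := Hit.r_abs G A Y AY v
        have h3 : |(-f x) * h v| ≤ 1 := by
          rw [abs_mul, abs_neg]
          exact mul_le_one₀ (fab x) (abs_nonneg _) (hab v)
        rw [abs_le] at *
        constructor <;> linarith) (fun v => by
      by_cases hv : v ∈ Z
      · left
        have h4 := h0 v hv
        rcases hv with hv | hv
        · have : Hit.r G A Y v = 1 := Hit.r_one G A Y AY v hv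
          simp [f1 v hv, this, h4]
        · have : Hit.r G A Y v = 0 := Hit.r_zero G A Y v (ZY (BZ hv)) (nA v hv)
          simp [f0 v hv, this, h4]
      · by_cases hvx : v = x
        · left
          have : Hit.r G A Y x = 0 := Hit.r_zero G A Y x (xY rfl) xA
          simp [hvx, this, hhx]
        · refine Or.inr ⟨hv, ?_⟩
          rw [Hit.lap_lin, Hit.lap_lin, fH v hv, hH v hv hvx,
            Hit.r_harm G A Y AY v (nY v hv hvx)]
          simp)
    intro v
    have := this v
    linarith
  -- sums
  have lB : ∀ b : B, graphLap G f b = ∑ w ∈ G.neighborFinset (b : V), f w := by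
    intro b; rw [Hit.lap_eq, f0 b b.2]; simp
  have S1 : HasSum (fun v : A => graphLap G f v) (-∑' u : B, graphLap G f u) := by
    rw [tsum_congr lB]
    rw [funext lB] at hL
    have := (Hit.rev_real G A B Z AZ BZ hL).neg
    refine Eq.mp (congrArg (fun F => HasSum F _) (funext fun v => Eq.symm ?_)) this
    rw [Finset.sum_congr rfl fun w _ => ff w]
    rw [graphLap, ← Finset.sum_neg_distrib]
    refine Finset.sum_congr rfl fun w _ => ?_
    rw [f1 v v.2]; ring
  have S2 : HasSum (fun v : A => graphLap G h v) (-(f x * graphLap G h x)) := by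
    have := Hit.rev_real G A {x} Y AY xY (Summable.of_finite)
    convert this using 2 with v
    · rw [Hit.lap_eq, h0 v (AZ v.2)]; simp
      rfl
    · rw [tsum_fintype]
      simp only [Finset.univ_unique, Set.default_coe_singleton, Finset.sum_singleton]
      rw [Finset.sum_congr rfl fun w _ => qq w]
      have hz := fH x hx
      rw [Hit.lap_eq] at hz
      rw [Hit.lap_eq, hhx, Finset.sum_sub_distrib, ← Finset.mul_sum]
      linarith
  -- g = f + c h
  have gg : ∀ v, g v = f v + (g x - f x) * h v := by
    have := U (fun v => (f v + (g x - f x) * h v) + (-1) * g v) (1 + |g x - f x| + M) (fun v => by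
        have h1 := fab v
        have h2 := hM v
        have h3 : |(g x - f x) * h v| ≤ |g x - f x| := by
          rw [abs_mul]
          exact mul_le_of_le_one_right (abs_nonneg _) (hab v)
        generalize |g x - f x| = K at *
        rw [abs_le] at *
        constructor <;> linarith) (fun v => by
      by_cases hv : v ∈ Z
      · left
        have h4 := h0 v hv
        rcases hv with hv | hv
        · simp [f1 v hv, gA v hv, h4]
        · simp [f0 v hv, gB v hv, h4]
      · by_cases hvx : v = x
        · left
          simp [hvx, hhx]
        · refine Or.inr ⟨hv, ?_⟩
          rw [Hit.lap_lin, Hit.lap_lin, fH v hv, hH v hv hvx, gH v hv hvx]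
          simp)
    intro v
    have := this v
    linarith
  have gl : ∀ v, graphLap G g v = graphLap G f v + (g x - f x) * graphLap G h v := by
    intro v
    rw [← Hit.lap_lin]
    congr 1
    exact funext gg
  have S3 := (S1.add (S2.mul_left (g x - f x))).tsum_eq
  simp_rw [← gl] at S3
  rw [gS] at S3
  have hd : -(f x * graphLap G h x) ≠ 0 := neg_ne_zero.2 (mul_ne_zero hfx.ne' hne)
  funext v
  rw [gg v]
  congr 1
  rw [eq_div_iff hd]
  linear_combination (-h v) * S3
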